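/- Let q be an acyclic Boolean conjunctive query and τ a join tree for q. If every cycle in the attack graph of τ is terminal, then every cycle in the attack graph of τ has length 2. -/

import Mathlib

attribute [local instance] Classical.propDecidable

noncomputable section

/-- A term is either a variable (`Sum.inl v`) or a constant (`Sum.inr c`),
variables and constants both being coded by natural numbers
(the two copies of `ℕ` are disjoint). -/
abbrev Trm := ℕ ⊕ ℕ

/-- A database schema assigns to every relation name (a natural number) an
arity `n` and a primary-key length `k` with `n ≥ k ≥ 1`; the primary key
consists of the first `k` positions. -/
structure Schema where
  arity : ℕ → ℕ
  keyLen : ℕ → ℕ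
  keyLen_le_arity : ∀ R, keyLen R ≤ arity R
  one_le_keyLen : ∀ R, 1 ≤ keyLen R

/-- An atom: a relation name together with a list of arguments. -/
structure Atom where
  rel : ℕ
  args : List Trm
deriving DecidableEq

/-- Variables occurring in a list of terms. -/
def varsL (l : List Trm) : Finset ℕ := (l.filterMap Sum.getLeft?).toFinset

/-- Constants occurring in a list of terms. -/
def constsL (l : List Trm) : Finset ℕ := (l.filterMap Sum.getRight?).toFinset

/-- All variables of an atom. -/
def varsA (A : Atom) : Finset ℕ := varsL A.args

/-- Key variables of an atom: variables in the primary-key positions. -/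
def keyVars (S : Schema) (A : Atom) : Finset ℕ := varsL (A.args.take (S.keyLen A.rel))

/-- Constants of an atom. -/
def constsA (A : Atom) : Finset ℕ := constsL A.args

/-- Well-formed atom: number of arguments equals the arity of its relation name. -/
def wfAtom (S : Schema) (A : Atom) : Prop := A.args.length = S.arity A.rel

/-- A fact is an atom without variables. -/
def isFact (A : Atom) : Prop := ∀ t ∈ A.args, ∃ c : ℕ, t = Sum.inr c

/-- Two (facts) are key-equal: same relation name, and same primary-key positions. -/
def keyEqual (S : Schema) (A B : Atom) : Prop :=
  A.rel = B.rel ∧ A.args.take (S.keyLen A.rel) = B.args.take (S.keyLen B.rel)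

/-- The block of `A` in `db`: all facts of `db` key-equal to `A`. -/
def block (S : Schema) (A : Atom) (db : Finset Atom) : Finset Atom :=
  db.filter (fun B => keyEqual S A B)

/-- An uncertain database: a finite set of well-formed facts. -/
def IsDb (S : Schema) (db : Finset Atom) : Prop := ∀ A ∈ db, isFact A ∧ wfAtom S A

/-- A set of facts is consistent if it contains no two distinct key-equal facts. -/
def Consistent (S : Schema) (db : Finset Atom) : Prop :=
  ∀ A ∈ db, ∀ B ∈ db, keyEqual S A B → A = B

/-- A repair of `db`: a maximal consistent subset of `db`. -/
def IsRepair (S : Schema) (db r : Finset Atom) : Prop :=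
  r ⊆ db ∧ Consistent S r ∧
    ∀ r' : Finset Atom, r ⊆ r' → r' ⊆ db → Consistent S r' → r' = r

/-- Applying a valuation (a total map from variables to constants) to a term. -/
def appT (θ : ℕ → ℕ) : Trm → Trm
  | Sum.inl v => Sum.inr (θ v)
  | Sum.inr c => Sum.inr c

/-- Applying a valuation to an atom. -/
def appA (θ : ℕ → ℕ) (A : Atom) : Atom := ⟨A.rel, A.args.map (appT θ)⟩

/-- Applying a valuation to a query. -/
def appQ (θ : ℕ → ℕ) (q : Finset Atom) : Finset Atom := q.image (appA θ)

/-- `db ⊨ q`: some valuation sends every atom of `q` into `db`. -/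
def Sat (db q : Finset Atom) : Prop := ∃ θ : ℕ → ℕ, appQ θ q ⊆ db

/-- `db ∈ CERTAINTY(q)`: every repair of `db` satisfies `q`. -/
def Certainty (S : Schema) (q db : Finset Atom) : Prop :=
  ∀ r : Finset Atom, IsRepair S db r → Sat r q

/-- Variables of a query. -/
def varsQ (q : Finset Atom) : Finset ℕ := q.biUnion varsA

/-- Constants of a query. -/
def constsQ (q : Finset Atom) : Finset ℕ := q.biUnion constsA

/-- `q` has no self-join: no two distinct atoms share a relation name. -/
def NoSelfJoin (q : Finset Atom) : Prop := ∀ F ∈ q, ∀ G ∈ q, F.rel = G.rel → F = G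

/-- `db` is purified relative to `q`. -/
def Purified (q db : Finset Atom) : Prop :=
  ∀ A ∈ db, ∃ θ : ℕ → ℕ, A ∈ appQ θ q ∧ appQ θ q ⊆ db

/-- Active domain of a database: all constants occurring in its facts. -/
def adom (db : Finset Atom) : Finset ℕ := db.biUnion constsA

/-- Membership in the attribute closure of `X` under a set `FDs` of
functional dependencies (standard implication of functional dependencies). -/
inductive InCl (FDs : Set (Finset ℕ × Finset ℕ)) (X : Finset ℕ) : ℕ → Prop
  | base {x : ℕ} : x ∈ X → InCl FDs X x
  | step {Z W : Finset ℕ} {w : ℕ} : (Z, W) ∈ FDs → (∀ z ∈ Z, InCl FDs X z) →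
      w ∈ W → InCl FDs X w

/-- `FDs ⊨ X → Y`. -/
def FDImp (FDs : Set (Finset ℕ × Finset ℕ)) (X Y : Finset ℕ) : Prop :=
  ∀ y ∈ Y, InCl FDs X y

/-- `FD(q) = { key(F) → vars(F) : F ∈ q }`. -/
def FDq (S : Schema) (q : Finset Atom) : Set (Finset ℕ × Finset ℕ) :=
  {p | ∃ F ∈ q, p = (keyVars S F, varsA F)}

/-- `F^{+,q} = {x ∈ vars(q) : FD(q \ {F}) ⊨ key(F) → x}`. -/
def plusCl (S : Schema) (q : Finset Atom) (F : Atom) : Set ℕ :=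
  {x | x ∈ varsQ q ∧ InCl (FDq S (q.erase F)) (keyVars S F) x}

/-- `F^{⊕,q} = {x ∈ vars(q) : FD(q) ⊨ key(F) → x}`. -/
def oplusCl (S : Schema) (q : Finset Atom) (F : Atom) : Set ℕ :=
  {x | x ∈ varsQ q ∧ InCl (FDq S q) (keyVars S F) x}

/-- A (simple) path in an undirected graph given by edge relation `E`. -/
def IsPath (E : Atom → Atom → Prop) (p : List Atom) : Prop :=
  p ≠ [] ∧ p.Nodup ∧ List.Chain' E p

/-- `E` is (the edge relation of) a join tree for `q`: a tree (unique simple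
paths between any two vertices) on the atoms of `q` satisfying the
Connectedness Condition. -/
def IsJoinTree (q : Finset Atom) (E : Atom → Atom → Prop) : Prop :=
  (∀ a b, E a b → E b a) ∧
  (∀ a b, E a b → a ∈ q ∧ b ∈ q ∧ a ≠ b) ∧
  (∀ a ∈ q, ∀ b ∈ q, ∃! p : List Atom,
      IsPath E p ∧ p.head? = some a ∧ p.getLast? = some b) ∧
  (∀ x : ℕ, ∀ F ∈ q, ∀ G ∈ q, x ∈ varsA F → x ∈ varsA G →
      ∀ p : List Atom, IsPath E p → p.head? = some F → p.getLast? = some G →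
        ∀ H ∈ p, x ∈ varsA H)

/-- The consecutive pairs (edges) of a path. -/
def edgePairs (p : List Atom) : List (Atom × Atom) := p.zip p.tail

/-- `F ↝ G` in the attack graph of the join tree `E` of `q`: `F ≠ G` are atoms
of `q`, and no label `vars(H) ∩ vars(H')` of an edge on the (unique) path from
`F` to `G` is contained in `F^{+,q}`. -/
def Attacks (S : Schema) (q : Finset Atom) (E : Atom → Atom → Prop) (F G : Atom) : Prop :=
  F ∈ q ∧ G ∈ q ∧ F ≠ G ∧
  ∀ p : List Atom, IsPath E p → p.head? = some F → p.getLast? = some G →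
    ∀ e ∈ edgePairs p, ¬ ((↑(varsA e.1 ∩ varsA e.2) : Set ℕ) ⊆ plusCl S q F)

/-- The attack `F ↝ G` is weak: `key(G) ⊆ F^{⊕,q}`. -/
def Weak (S : Schema) (q : Finset Atom) (F G : Atom) : Prop :=
  (↑(keyVars S G) : Set ℕ) ⊆ oplusCl S q F

/-- Consecutive pairs of a cyclic sequence, including the wrap-around pair. -/
def cyclePairs (L : List Atom) : List (Atom × Atom) := L.zip (L.rotate 1)

/-- `L` is an (elementary directed) cycle in the directed graph `att`. -/
def IsCycle (att : Atom → Atom → Prop) (L : List Atom) : Prop :=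
  2 ≤ L.length ∧ L.Nodup ∧ ∀ e ∈ cyclePairs L, att e.1 e.2

/-- A cycle is terminal: no edge leads from a vertex in the cycle to a vertex
outside the cycle. -/
def TerminalCycle (att : Atom → Atom → Prop) (L : List Atom) : Prop :=
  ∀ a ∈ L, ∀ b, att a b → b ∈ L

/-- A strong cycle in the attack graph: a cycle at least one attack of which is strong. -/
def StrongCycle (S : Schema) (q : Finset Atom) (E : Atom → Atom → Prop)
    (L : List Atom) : Prop :=
  IsCycle (Attacks S q E) L ∧ ∃ e ∈ cyclePairs L, ¬ Weak S q e.1 e.2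

/-- Substituting constant `c` for variable `z` in a term. -/
def substT (z c : ℕ) : Trm → Trm
  | Sum.inl v => if v = z then Sum.inr c else Sum.inl v
  | Sum.inr d => Sum.inr d

/-- `F[z→c]`. -/
def substA (z c : ℕ) (A : Atom) : Atom := ⟨A.rel, A.args.map (substT z c)⟩

/-- `q[z→c]`. -/
def substQ (z c : ℕ) (q : Finset Atom) : Finset Atom := q.image (substA z c)

/-- Simultaneous substitution of the constants `bs` for the (distinct)
variables `xs` (componentwise) in a term. -/
def substLT (xs bs : List ℕ) : Trm → Trm
  | Sum.inl v => if v ∈ xs then Sum.inr (bs.getD (xs.idxOf v) 0) else Sum.inl v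
  | Sum.inr d => Sum.inr d

/-- `F[x⃗→b⃗]`. -/
def substLA (xs bs : List ℕ) (A : Atom) : Atom := ⟨A.rel, A.args.map (substLT xs bs)⟩

/-- `q[x⃗→b⃗]`. -/
def substLQ (xs bs : List ℕ) (q : Finset Atom) : Finset Atom := q.image (substLA xs bs)

/-- First-order formulas over the relational vocabulary (relation names and
constants coded by naturals, variables coded by naturals). -/
inductive Fml where
  | atom (R : ℕ) (args : List Trm)
  | eq (s t : Trm)
  | tru
  | not (φ : Fml)
  | and (φ ψ : Fml)
  | or (φ ψ : Fml)
  | ex (v : ℕ) (φ : Fml)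
  | all (v : ℕ) (φ : Fml)

/-- Value of a term under an assignment of constants to variables. -/
def evalT (σ : ℕ → ℕ) : Trm → ℕ
  | Sum.inl v => σ v
  | Sum.inr c => c

/-- Satisfaction of a first-order formula in the finite structure whose
relations are given by the facts of `db`, with quantifiers ranging over `dom`. -/
def Holds (db : Finset Atom) (dom : Finset ℕ) : Fml → (ℕ → ℕ) → Prop
  | .atom R args, σ => (⟨R, args.map fun t => Sum.inr (evalT σ t)⟩ : Atom) ∈ db
  | .eq s t, σ => evalT σ s = evalT σ t
  | .tru, _ => True
  | .not φ, σ => ¬ Holds db dom φ σ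
  | .and φ ψ, σ => Holds db dom φ σ ∧ Holds db dom ψ σ
  | .or φ ψ, σ => Holds db dom φ σ ∨ Holds db dom ψ σ
  | .ex v φ, σ => ∃ a ∈ dom, Holds db dom φ (Function.update σ v a)
  | .all v φ, σ => ∀ a ∈ dom, Holds db dom φ (Function.update σ v a)

/-- Free variables of a formula. -/
def Fml.free : Fml → Finset ℕ
  | .atom _ args => varsL args
  | .eq s t => varsL [s, t]
  | .tru => ∅
  | .not φ => φ.free
  | .and φ ψ => φ.free ∪ ψ.free
  | .or φ ψ => φ.free ∪ ψ.free
  | .ex v φ => φ.free.erase v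
  | .all v φ => φ.free.erase v

/-- Relation names occurring in a formula. -/
def Fml.rels : Fml → Finset ℕ
  | .atom R _ => {R}
  | .eq _ _ => ∅
  | .tru => ∅
  | .not φ => φ.rels
  | .and φ ψ => φ.rels ∪ ψ.rels
  | .or φ ψ => φ.rels ∪ ψ.rels
  | .ex _ φ => φ.rels
  | .all _ φ => φ.rels

/-- Constants occurring in a formula. -/
def Fml.consts : Fml → Finset ℕ
  | .atom _ args => constsL args
  | .eq s t => constsL [s, t]
  | .tru => ∅
  | .not φ => φ.consts
  | .and φ ψ => φ.consts ∪ ψ.consts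
  | .or φ ψ => φ.consts ∪ ψ.consts
  | .ex _ φ => φ.consts
  | .all _ φ => φ.consts

/-- Well-formed formula: every atom has as many arguments as the arity of its
relation name. -/
def FmlWf (S : Schema) : Fml → Prop
  | .atom R args => args.length = S.arity R
  | .eq _ _ => True
  | .tru => True
  | .not φ => FmlWf S φ
  | .and φ ψ => FmlWf S φ ∧ FmlWf S ψ
  | .or φ ψ => FmlWf S φ ∧ FmlWf S ψ
  | .ex _ φ => FmlWf S φ
  | .all _ φ => FmlWf S φ

/-- The safety predicate of Dalvi, Ré and Suciu (rules SE1–SE4). -/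
inductive Safe (S : Schema) : Finset Atom → Prop
  | se1 (A : Atom) : isFact A → Safe S {A}
  | se2 (q₁ q₂ : Finset Atom) : q₁.Nonempty → q₂.Nonempty →
      Disjoint (varsQ q₁) (varsQ q₂) → Safe S q₁ → Safe S q₂ → Safe S (q₁ ∪ q₂)
  | se3 (q : Finset Atom) (x a : ℕ) : (∀ F ∈ q, x ∈ keyVars S F) →
      Safe S (substQ x a q) → Safe S q
  | se4 (q : Finset Atom) (F : Atom) (x a : ℕ) : F ∈ q → keyVars S F = ∅ →
      varsA F ≠ ∅ → x ∈ varsA F → Safe S (substQ x a q) → Safe S q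

/-- The atom `R_i(x_i ; x_{i+1})` (with `x_{k+1} = x_1`) of the query `acq_k`;
variable `x_i` is coded by `i`, relation name `R_i` by `i`. -/
def Ratom (k i : ℕ) : Atom := ⟨i, [Sum.inl i, Sum.inl (i % k + 1)]⟩

/-- The all-key atom `S_k(x_1,…,x_k)` of the query `acq_k`;
relation name `S_k` is coded by `0`. -/
def Satom (k : ℕ) : Atom := ⟨0, (List.range k).map (fun j => Sum.inl (j + 1))⟩

/-- The query `acq_k = {R_1(x_1;x_2), …, R_k(x_k;x_1), S_k(x_1,…,x_k)}`. -/
def acq (k : ℕ) : Finset Atom := ((Finset.Icc 1 k).image (Ratom k)) ∪ {Satom k}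

/-- Sum of `Pr` over the possible (= consistent) worlds of `db` satisfying `P`. -/
def prOf (S : Schema) (db : Finset Atom) (Pr : Finset Atom → ℚ)
    (P : Finset Atom → Prop) : ℚ :=
  ∑ w ∈ db.powerset.filter (fun w => Consistent S w ∧ P w), Pr w

end
lemma s7_key_sub (S : Schema) (A : Atom) : keyVars S A ⊆ varsA A := by
  intro x hx
  simp only [keyVars, varsA, varsL, List.mem_toFinset, List.mem_filterMap] at hx ⊢
  obtain ⟨t, ht, h⟩ := hx
  exact ⟨t, List.mem_of_mem_take ht, h⟩

/-- Two atoms of `q` share a variable outside the closure of `F`. -/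
def s7R (S : Schema) (q : Finset Atom) (F a b : Atom) : Prop :=
  a ∈ q ∧ b ∈ q ∧ ∃ x ∈ varsA a, x ∈ varsA b ∧ x ∉ plusCl S q F

lemma s7_chain_rtg {α : Type*} {r : α → α → Prop} :
    ∀ (p : List α) (a b : α), List.IsChain r p → p.head? = some a → p.getLast? = some b →
      Relation.ReflTransGen r a b := by
  intro p
  induction p with
  | nil => intro a b _ h; simp at h
  | cons c t ih =>
    intro a b hc ha hb
    simp only [List.head?_cons, Option.some.injEq] at ha
    subst ha
    cases t with
    | nil =>
      simp only [List.getLast?_singleton, Option.some.injEq] at hb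
      subst hb; exact .refl
    | cons d t =>
      rw [List.isChain_cons_cons] at hc
      rw [List.getLast?_cons_cons] at hb
      exact .head hc.1 (ih d b hc.2 rfl hb)

lemma s7_rtg_path {α : Type*} {r : α → α → Prop} {a b : α} (h : Relation.ReflTransGen r a b) :
    ∃ p : List α, p ≠ [] ∧ p.Nodup ∧ List.IsChain r p ∧ p.head? = some a ∧
      p.getLast? = some b := by
  induction h using Relation.ReflTransGen.head_induction_on with
  | refl => exact ⟨[b], by simp⟩
  | @head a c hac _ ih =>
    obtain ⟨p, hne, hnd, hch, hh, hl⟩ := ih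
    by_cases hm : a ∈ p
    · obtain ⟨s, t, rfl⟩ := List.append_of_mem hm
      refine ⟨a :: t, by simp, (List.nodup_append.1 hnd).2.1, ?_, rfl, ?_⟩
      · exact hch.right_of_append
      · simpa using hl
    · cases p with
      | nil => simp at hne
      | cons d t =>
        simp only [List.head?_cons, Option.some.injEq] at hh
        subst hh
        refine ⟨a :: d :: t, by simp, List.nodup_cons.2 ⟨hm, hnd⟩, ?_, rfl, ?_⟩
        · exact List.isChain_cons_cons.2 ⟨hac, hch⟩
        · rwa [List.getLast?_cons_cons]

lemma s7_chain_pairs {r : Atom → Atom → Prop} :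
    ∀ (p : List Atom), List.IsChain r p ↔ ∀ e ∈ edgePairs p, r e.1 e.2 := by
  intro p
  induction p with
  | nil => simp [edgePairs]
  | cons c t ih =>
    cases t with
    | nil => simp [edgePairs]
    | cons d t =>
      rw [List.isChain_cons_cons, ih]
      simp [edgePairs]

lemma s7_mem_pairs {p : List Atom} {e : Atom × Atom} (h : e ∈ edgePairs p) :
    e.1 ∈ p ∧ e.2 ∈ p := by
  have := List.of_mem_zip (a := e.1) (b := e.2) h
  exact ⟨this.1, List.mem_of_mem_tail this.2⟩

lemma s7_attack_rtg {S : Schema} {q : Finset Atom} {E : Atom → Atom → Prop}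
    (hjt : IsJoinTree q E) {F G : Atom} (h : Attacks S q E F G) :
    Relation.ReflTransGen (s7R S q F) F G := by
  obtain ⟨hF, hG, _, hall⟩ := h
  obtain ⟨p, ⟨hp, hh, hl⟩, _⟩ := hjt.2.2.1 F hF G hG
  refine s7_chain_rtg p F G ?_ hh hl
  rw [s7_chain_pairs]
  intro e he
  have hE := (s7_chain_pairs p).1 hp.2.2 e he
  have hn := hall p hp hh hl e he
  rw [Set.not_subset] at hn
  obtain ⟨x, hx, hxn⟩ := hn
  simp only [Finset.coe_inter, Set.mem_inter_iff, Finset.mem_coe] at hx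
  exact ⟨(hjt.2.1 _ _ hE).1, (hjt.2.1 _ _ hE).2.1, x, hx.1, hx.2, hxn⟩

lemma s7_rtg_attack {S : Schema} {q : Finset Atom} {E : Atom → Atom → Prop}
    (hjt : IsJoinTree q E) {F G : Atom} (hF : F ∈ q) (hG : G ∈ q) (hne : F ≠ G)
    (h : Relation.ReflTransGen (s7R S q F) F G) : Attacks S q E F G := by
  let E' : Atom → Atom → Prop := fun a b =>
    E a b ∧ ¬ ((↑(varsA a ∩ varsA b) : Set ℕ) ⊆ plusCl S q F)
  have h2 : Relation.ReflTransGen E' F G := by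
    clear hne hG
    induction h with
    | refl => exact .refl
    | @tail b c _ hbc ih =>
      refine ih.trans ?_
      obtain ⟨hb, hc, x, hxb, hxc, hx⟩ := hbc
      obtain ⟨p, ⟨hp, hh, hl⟩, _⟩ := hjt.2.2.1 b hb c hc
      refine s7_chain_rtg p b c ?_ hh hl
      rw [s7_chain_pairs]
      intro e he
      refine ⟨(s7_chain_pairs p).1 hp.2.2 e he, fun hs => hx (hs ?_)⟩
      have hm := s7_mem_pairs he
      have hv := hjt.2.2.2 x b hb c hc hxb hxc p hp hh hl
      simp only [Finset.coe_inter, Set.mem_inter_iff, Finset.mem_coe]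
      exact ⟨hv _ hm.1, hv _ hm.2⟩
  obtain ⟨p, hpne, hnd, hch, hh, hl⟩ := s7_rtg_path h2
  refine ⟨hF, hG, hne, fun p' hp' hh' hl' => ?_⟩
  have hp : IsPath E p := ⟨hpne, hnd, hch.imp fun _ _ h => h.1⟩
  have : p' = p := (hjt.2.2.1 F hF G hG).unique ⟨hp', hh', hl'⟩ ⟨hp, hh, hl⟩
  subst this
  intro e he
  exact ((s7_chain_pairs _).1 hch e he).2

lemma s7_trans {S : Schema} {q : Finset Atom} {E : Atom → Atom → Prop}
    (hjt : IsJoinTree q E) {F G H : Atom} (h1 : Attacks S q E F G) (h2 : Attacks S q E G H)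
    (hFH : F ≠ H) : Attacks S q E F H ∨ Attacks S q E G F := by
  by_cases h3 : Attacks S q E G F
  · exact Or.inr h3
  left
  have r1 := s7_attack_rtg hjt h1
  have r2 := s7_attack_rtg hjt h2
  have hF := h1.1
  have hG := h1.2.1
  have hGF : ¬ Relation.ReflTransGen (s7R S q G) G F := fun h =>
    h3 (s7_rtg_attack hjt hG hF h1.2.2.1.symm h)
  have hvq : ∀ K ∈ q, ∀ x ∈ varsA K, x ∈ varsQ q := fun K hK x hx =>
    Finset.mem_biUnion.2 ⟨K, hK, hx⟩
  -- the key of `G` is not in the closure of `F`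
  have hkG : ¬ ∀ z ∈ keyVars S G, InCl (FDq S (q.erase F)) (keyVars S F) z := by
    intro hk
    rcases Relation.ReflTransGen.cases_tail r1 with h | ⟨c, _, _, _, x, _, hx, hxn⟩
    · exact h1.2.2.1 h.symm
    · refine hxn ⟨hvq G hG x hx, InCl.step ?_ hk hx⟩
      exact ⟨G, Finset.mem_erase.2 ⟨h1.2.2.1.symm, hG⟩, rfl⟩
  have claim : ∀ z, InCl (FDq S (q.erase F)) (keyVars S F) z →
      ∀ K ∈ q, Relation.ReflTransGen (s7R S q G) G K → z ∈ varsA K → z ∈ plusCl S q G := by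
    intro z hz
    induction hz with
    | @base x hx =>
      intro K hK hr hxK
      by_contra hn
      exact hGF (hr.tail ⟨hK, hF, x, hxK, s7_key_sub S F hx, hn⟩)
    | @step Z W w hfd hZ hw ih =>
      intro K hK hr hwK
      obtain ⟨A, hA, hAe⟩ := hfd
      obtain ⟨rfl, rfl⟩ := Prod.mk.inj hAe
      by_contra hn
      have hAq := (Finset.mem_erase.1 hA).2
      have hrA := hr.tail ⟨hK, hAq, w, hwK, hw, hn⟩
      have hAG : A ≠ G := by
        rintro rfl
        exact hkG hZ
      refine hn ⟨hvq A hAq w hw, InCl.step ⟨A, Finset.mem_erase.2 ⟨hAG, hAq⟩, rfl⟩ ?_ hw⟩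
      intro z hz
      exact (ih z hz A hAq hrA (s7_key_sub S A hz)).2
  have r3 : Relation.ReflTransGen (s7R S q F) G H := by
    clear h2 hFH
    induction r2 with
    | refl => exact .refl
    | @tail b c hb hbc ih =>
      obtain ⟨hbq, hcq, x, hxb, hxc, hxn⟩ := hbc
      exact ih.tail ⟨hbq, hcq, x, hxb, hxc, fun hx => hxn (claim x hx.2 b hbq hb hxb)⟩
  exact s7_rtg_attack hjt hF h2.2.1 hFH (r1.trans r3)

/-- If every cycle in the attack graph of a join tree for `q` is
terminal, then every cycle in that attack graph has length 2. -/
theorem statement7 (S : Schema) (q : Finset Atom) (hq : ∀ F ∈ q, wfAtom S F)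
    (E : Atom → Atom → Prop) (hjt : IsJoinTree q E)
    (hterm : ∀ L : List Atom, IsCycle (Attacks S q E) L →
      TerminalCycle (Attacks S q E) L) :
    ∀ L : List Atom, IsCycle (Attacks S q E) L → L.length = 2 := by
  intro L hL
  obtain ⟨hlen, hnd, hatt⟩ := hL
  match L, hlen, hnd, hatt with
  | [a, b], _, _, _ => rfl
  | a :: b :: c :: t, _, hnd, hatt =>
    exfalso
    simp only [cyclePairs, List.rotate_cons_succ, List.rotate_zero, List.cons_append,
      List.zip_cons_cons, List.mem_cons, forall_eq_or_imp] at hatt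
    obtain ⟨hab, hbc, hrest⟩ := hatt
    simp only [List.nodup_cons, List.mem_cons, not_or] at hnd
    obtain ⟨⟨hab', hac', hat⟩, ⟨hbc', hbt⟩, hct, htn⟩ := hnd
    rcases s7_trans hjt hab hbc hac' with h | h
    · have hcyc : IsCycle (Attacks S q E) (a :: c :: t) := by
        refine ⟨by simp, by simp [hac', hat, hct, htn], ?_⟩
        simp only [cyclePairs, List.rotate_cons_succ, List.rotate_zero, List.cons_append,
          List.zip_cons_cons, List.mem_cons, forall_eq_or_imp]
        exact ⟨h, hrest⟩
      have := hterm _ hcyc a (by simp) b hab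
      simp only [List.mem_cons] at this
      rcases this with h | h | h
      · exact hab' h.symm
      · exact hbc' h
      · exact hbt h
    · have hcyc : IsCycle (Attacks S q E) [a, b] := by
        refine ⟨by simp, by simp [hab'], ?_⟩
        simp [cyclePairs, hab, h]
      have := hterm _ hcyc b (by simp) c hbc
      simp only [List.mem_cons, List.not_mem_nil, or_false] at this
      rcases this with h | h
      · exact hac' h.symm
      · exact hbc' h.symm
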